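/- Continuity of the distribution function of the supremum of a Gaussian process: let (T, d) be a compact metric space, (Ω, ℱ, ℙ) a probability space, and Z : Ω × T → ℝ a process such that t ↦ Z(ω,t) is continuous for every ω, every finite real linear combination Σᵢ cᵢ·Z(·, tᵢ) is a (possibly degenerate) Gaussian random variable, and E[Z(·,t)] = 0 and E[Z(·,t)²] = 1 for all t ∈ T. Then the function x₀ ↦ ℙ( sup_{t∈T} |Z(·,t)| ≤ x₀ ) is continuous on ℝ. -/

import Mathlib

open MeasureTheory ProbabilityTheory Filter Topology
open scoped ENNReal NNReal

noncomputable section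

/-- Generalized inverse (quantile function). -/
def qinv (G : ℝ → ℝ) (p : ℝ) : ℝ := sInf {x : ℝ | p ≤ G x}

/-- Integrated kernel `K̄`. -/
def Kbar (K : ℝ → ℝ) (x : ℝ) : ℝ := ∫ u in Set.Iic x, K u

/-- Kernel estimator of a distribution function. -/
def hatF {Ω : Type*} (K : ℝ → ℝ) (r : ℝ) (n : ℕ) (X : ℕ → Ω → ℝ) (ω : Ω) (x : ℝ) : ℝ :=
  (1 / (n : ℝ)) * ∑ i ∈ Finset.range n, Kbar K ((x - X i ω) / r)

/-- Kernel density estimator. -/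
def kde {Ω : Type*} (K : ℝ → ℝ) (r : ℝ) (n : ℕ) (X : ℕ → Ω → ℝ) (ω : Ω) (x : ℝ) : ℝ :=
  (1 / ((n : ℝ) * r)) * ∑ i ∈ Finset.range n, K ((x - X i ω) / r)

/-- Kernel estimator of the optimal transport map. -/
def hatT {Ω : Type*} (K : ℝ → ℝ) (rP rQ : ℝ) (n mn : ℕ) (X Y : ℕ → Ω → ℝ) (ω : Ω) (x : ℝ) : ℝ :=
  qinv (hatF K rQ mn Y ω) (hatF K rP n X ω x)

/-- Plug-in estimator of the standard deviation. -/
def hatS {Ω : Type*} (K : ℝ → ℝ) (rP rQ : ℝ) (n mn : ℕ) (X Y : ℕ → Ω → ℝ) (ω : Ω) (x : ℝ) : ℝ :=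
  (1 / kde K rQ mn Y ω (hatT K rP rQ n mn X Y ω x)) *
    Real.sqrt (((((n : ℝ) + (mn : ℝ)) / (n : ℝ)) + (((n : ℝ) + (mn : ℝ)) / (mn : ℝ))) *
      (hatF K rP n X ω x * (1 - hatF K rP n X ω x)))

/-- The limiting standard deviation `s_κ`. -/
def sKappa (F_P F_Q f_Q : ℝ → ℝ) (κ : ℝ) (x : ℝ) : ℝ :=
  (1 / f_Q (qinv F_Q (F_P x))) *
    Real.sqrt ((1 / κ + 1 / (1 - κ)) * (F_P x * (1 - F_P x)))

/-- Assumption 1 of the paper. -/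
def Assumption1 (F_P F_Q f_P f_Q K : ℝ → ℝ) (β : ℝ) (r : ℕ → ℝ) : Prop :=
  0 ≤ β ∧
  (∀ x, HasDerivAt F_P (f_P x) x) ∧ (∀ x, HasDerivAt F_Q (f_Q x) x) ∧
  (∃ M, ∀ x, |f_P x| ≤ M) ∧ (∃ M, ∀ x, |f_Q x| ≤ M) ∧
  ContDiff ℝ (⌊β⌋₊ : ℕ∞) f_P ∧ ContDiff ℝ (⌊β⌋₊ : ℕ∞) f_Q ∧
  (∃ C : ℝ≥0, HolderWith C (β - (⌊β⌋₊ : ℝ)).toNNReal (iteratedDeriv ⌊β⌋₊ f_P)) ∧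
  (∃ C : ℝ≥0, HolderWith C (β - (⌊β⌋₊ : ℝ)).toNNReal (iteratedDeriv ⌊β⌋₊ f_Q)) ∧
  (∃ s : ℝ, β + 1 / 2 < s ∧ ∀ j : ℕ, 1 ≤ j → (j : ℝ) ≤ s → ∫ u, u ^ j * K u = 0) ∧
  (∃ c : ℝ, 0 < c ∧
    Tendsto (fun n : ℕ => (n : ℝ) ^ ((1 : ℝ) / (2 * β + 1)) * r n) atTop (𝓝 c))

/-- Assumption 2 of the paper. -/
def Assumption2 (F_P F_Q f_Q K : ℝ → ℝ) (a b : ℝ) : Prop :=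
  (∀ y ∈ Set.Icc (qinv F_Q (F_P a)) (qinv F_Q (F_P b)), 0 < f_Q y) ∧
  BoundedVariationOn K Set.univ

/-- Empirical distribution function of the first `n` sample variables. -/
def empF {Ω : Type*} (n : ℕ) (X : ℕ → Ω → ℝ) (ω : Ω) (x : ℝ) : ℝ :=
  (1 / (n : ℝ)) * ∑ i ∈ Finset.range n, if X i ω ≤ x then (1 : ℝ) else 0

/-- Empirical distribution function of a (bootstrap) sample vector. -/
def empCDF {k : ℕ} (xs : Fin k → ℝ) (x : ℝ) : ℝ :=
  (1 / (k : ℝ)) * ∑ i, if xs i ≤ x then (1 : ℝ) else 0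

/-- Empirical measure of the first `n` sample variables. -/
def empLaw {Ω : Type*} [MeasurableSpace Ω] (n : ℕ) (X : ℕ → Ω → ℝ) (ω : Ω) : Measure ℝ :=
  ((n : ℝ≥0∞))⁻¹ • ∑ i ∈ Finset.range n, Measure.dirac (X i ω)

/-- Law of a single smoothed-bootstrap draw: the measure with density `kde`,
i.e. with distribution function `hatF`. -/
def smoothBootLaw {Ω : Type*} (K : ℝ → ℝ) (r : ℝ) (n : ℕ) (X : ℕ → Ω → ℝ) (ω : Ω) : Measure ℝ :=
  (volume : Measure ℝ).withDensity fun x => ENNReal.ofReal (kde K r n X ω x)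

/-- A real random variable with a (possibly degenerate) Gaussian law. -/
def IsGaussianRV {Ω : Type*} [MeasurableSpace Ω] (μ : Measure Ω) (Z : Ω → ℝ) : Prop :=
  ∃ (c : ℝ) (v : ℝ≥0), Measure.map Z μ = gaussianReal c v

/-- A standard Brownian motion: a centered Gaussian process with continuous paths and
covariance `min s t` (for nonnegative times). -/
structure IsStdBrownianMotion {Ω : Type*} [MeasurableSpace Ω] (μ : Measure Ω)
    (B : Ω → ℝ → ℝ) : Prop where
  measurable : ∀ t, Measurable fun ω => B ω t
  continuous_paths : ∀ ω, Continuous (B ω)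
  gaussian : ∀ (k : ℕ) (t : Fin k → ℝ) (c : Fin k → ℝ), (∀ i, 0 ≤ t i) →
    IsGaussianRV μ fun ω => ∑ i, c i * B ω (t i)
  mean_zero : ∀ t, 0 ≤ t → ∫ ω, B ω t ∂μ = 0
  cov : ∀ s t, 0 ≤ s → 0 ≤ t → ∫ ω, B ω s * B ω t ∂μ = min s t

/-- The standard Brownian bridge built from a Brownian motion. -/
def bridge {Ω : Type*} (B : Ω → ℝ → ℝ) (ω : Ω) (t : ℝ) : ℝ := B ω t - t * B ω 1

/-- The limiting Gaussian process `Z_κ`. -/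
def Zproc {Ω' : Type*} (F_P : ℝ → ℝ) (κ : ℝ) (B₁ B₂ : Ω' → ℝ → ℝ) (ω : Ω') (x : ℝ) : ℝ :=
  (Real.sqrt (1 / κ) * bridge B₁ ω (F_P x) - Real.sqrt (1 / (1 - κ)) * bridge B₂ ω (F_P x)) /
    Real.sqrt ((1 / κ + 1 / (1 - κ)) * (F_P x * (1 - F_P x)))

/-- Standard normal distribution function `Φ`. -/
def stdNormalCDF (x : ℝ) : ℝ := (gaussianReal 0 1 (Set.Iic x)).toReal

/-- Bootstrap probability (given the data `ω`) that the scaled uniform bootstrap deviation of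
the OT-map estimator is at most `t`. -/
def bootBandProb {Ω : Type*} [MeasurableSpace Ω] (K : ℝ → ℝ) (rP rQ : ℝ) (n mn : ℕ)
    (X Y : ℕ → Ω → ℝ) (a b : ℝ) (ω : Ω) (t : ℝ) : ℝ :=
  (((Measure.pi fun _ : Fin n => smoothBootLaw K rP n X ω).prod
      (Measure.pi fun _ : Fin mn => smoothBootLaw K rQ mn Y ω))
    {p : (Fin n → ℝ) × (Fin mn → ℝ) |
      ∀ x ∈ Set.Icc a b,
        Real.sqrt ((n : ℝ) + (mn : ℝ)) *
          (|qinv (empCDF p.2) (empCDF p.1 x) - hatT K rP rQ n mn X Y ω x| /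
            hatS K rP rQ n mn X Y ω x) ≤ t}).toReal


/-- A real process all of whose finite linear combinations are Gaussian is a Gaussian process. -/
theorem isGaussianProcess_of_isGaussianRV {T Ω : Type*} [MeasurableSpace Ω] {μ : Measure Ω}
    {X : T → Ω → ℝ}
    (h : ∀ (k : ℕ) (t : Fin k → T) (c : Fin k → ℝ), IsGaussianRV μ fun ω => ∑ i, c i * X (t i) ω) :
    IsGaussianProcess X μ where
  hasGaussianLaw I := by
    classical
    have hX (t : T) : AEMeasurable (X t) μ := by
      obtain ⟨m, v, hmv⟩ := h 1 (fun _ => t) fun _ => 1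
      simp only [Finset.univ_unique, one_mul, Finset.sum_const, Finset.card_singleton,
        one_smul] at hmv
      exact AEMeasurable.of_map_ne_zero (hmv ▸ IsProbabilityMeasure.ne_zero _)
    have hI : AEMeasurable (fun ω => I.restrict (X · ω)) μ :=
      aemeasurable_pi_lambda _ fun t => hX t
    refine ⟨isGaussian_of_map_eq_gaussianReal fun L => ?_⟩
    let e := I.equivFin
    obtain ⟨m, v, hmv⟩ := h I.card (fun i => (e.symm i : T))
      fun i => L (Pi.single (e.symm i) 1)
    refine ⟨m, v, ?_⟩
    rw [← hmv, AEMeasurable.map_map_of_aemeasurable (by fun_prop) hI]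
    congr 1
    ext ω
    rw [e.symm.sum_comp (fun i : I => L (Pi.single i 1) * X i ω)]
    conv_lhs => rw [Function.comp_apply, ← Finset.univ_sum_single (I.restrict (X · ω))]
    rw [map_sum]
    refine Finset.sum_congr rfl fun i _ => ?_
    rw [mul_comm, ← smul_eq_mul (X i ω), ← map_smul, ← Pi.single_smul]
    simp

/-- If `W` is independent of an absolutely continuous variable `g`, then almost surely `g` does not
lie on the boundary of the convex set `{u | ∀ n, |W n + ρ n * u| ≤ x}`. -/
theorem ae_exists_forall_abs_add_le {Ω : Type*} [MeasurableSpace Ω] {μ : Measure Ω}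
    [IsFiniteMeasure μ] {g : Ω → ℝ} {W : Ω → ℕ → ℝ} (hg : AEMeasurable g μ)
    (hW : AEMeasurable W μ) (hind : IndepFun W g μ) (hac : μ.map g ≪ volume)
    (ρ : ℕ → ℝ) (x : ℝ) :
    ∀ᵐ ω ∂μ, (∀ n, |W ω n + ρ n * g ω| ≤ x) →
      ∃ δ > 0, (∀ n, |W ω n + ρ n * (g ω + δ)| ≤ x) ∧ ∀ n, |W ω n + ρ n * (g ω - δ)| ≤ x := by
  let C (w : ℕ → ℝ) : Set ℝ := {u | ∀ n, |w n + ρ n * u| ≤ x}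
  have hC (δ : ℝ) : MeasurableSet {p : (ℕ → ℝ) × ℝ | p.2 + δ ∈ C p.1} := by
    refine MeasurableSet.congr (s := ⋂ n, {p | |p.1 n + ρ n * (p.2 + δ)| ≤ x})
      (.iInter fun n => measurableSet_le (by fun_prop) (by fun_prop)) ?_
    ext p
    simp [C]
  have hconv (w : ℕ → ℝ) : Convex ℝ (C w) := by
    have : C w = ⋂ n, {u | |w n + ρ n * u| ≤ x} := by ext u; simp [C]
    rw [this]
    refine convex_iInter fun n => ?_
    intro u hu v hv a b ha hb hab
    simp only [Set.mem_ofPred_eq, abs_le, smul_eq_mul] at *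
    obtain rfl : b = 1 - a := by linarith
    constructor <;> nlinarith [mul_le_mul_of_nonneg_left hu.1 ha, mul_le_mul_of_nonneg_left hu.2 ha,
      mul_le_mul_of_nonneg_left hv.1 hb, mul_le_mul_of_nonneg_left hv.2 hb]
  let A : Set ((ℕ → ℝ) × ℝ) := {p | p.2 + 0 ∈ C p.1} \
    ⋃ m : ℕ, {p | p.2 + 1 / ((m : ℝ) + 1) ∈ C p.1} ∩ {p | p.2 + -(1 / ((m : ℝ) + 1)) ∈ C p.1}
  have hA : MeasurableSet A :=
    (hC 0).diff (.iUnion fun m => (hC _).inter (hC _))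
  have hsec (w : ℕ → ℝ) : Prod.mk w ⁻¹' A ⊆ frontier (C w) := by
    rintro u ⟨hu, hu'⟩
    refine ⟨subset_closure (by simpa using hu), fun hint => hu' ?_⟩
    obtain ⟨ε, hε, hball⟩ := Metric.mem_nhds_iff.1 (mem_interior_iff_mem_nhds.1 hint)
    obtain ⟨m, hm⟩ := exists_nat_one_div_lt hε
    have hm0 : 0 < 1 / ((m : ℝ) + 1) := by positivity
    refine Set.mem_iUnion.2 ⟨m, hball ?_, hball ?_⟩ <;>
      simpa [abs_of_pos hm0, abs_of_pos (show 0 < (m : ℝ) + 1 by positivity)] using hm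
  have hnull : μ.map (fun ω => (W ω, g ω)) A = 0 := by
    rw [hind.map_prod_eq_prod_map_map hW hg, Measure.measure_prod_null hA]
    exact .of_forall fun w => hac (measure_mono_null (hsec w) ((hconv w).addHaar_frontier _))
  rw [Measure.map_apply_of_aemeasurable (hW.prodMk hg) hA] at hnull
  filter_upwards [measure_eq_zero_iff_ae_notMem.1 hnull] with ω hω hle
  by_contra! hcon
  refine hω ⟨by simpa [C] using hle, fun hmem => ?_⟩
  obtain ⟨m, h1, h2⟩ := Set.mem_iUnion.1 hmem
  obtain ⟨n, hn⟩ := hcon (1 / ((m : ℝ) + 1)) (by positivity) h1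
  exact absurd (h2 n) (not_le.2 hn)

namespace ProbabilityTheory.IsGaussianProcess

variable {T Ω : Type*} [MeasurableSpace Ω] {μ : Measure Ω} {X : T → Ω → ℝ}

/-- A centered Gaussian process with constant variance and continuous paths has a separately
continuous covariance. -/
theorem continuous_covariance [TopologicalSpace T] [FirstCountableTopology T]
    (hX : IsGaussianProcess X μ) (hcont : ∀ ω, Continuous fun t => X t ω)
    (hmean : ∀ t, ∫ ω, X t ω ∂μ = 0) {v : ℝ} (hvar : ∀ t, Var[X t; μ] = v) (s : T) :
    Continuous fun t => cov[X s, X t; μ] := by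
  have := hX.isProbabilityMeasure
  have hL (t : T) := hX.hasGaussianLaw_eval t
  have hchar (t : T) : ∫ ω, Complex.exp ((X s ω + X t ω : ℝ) * Complex.I) ∂μ =
      Real.exp (-(v + cov[X s, X t; μ])) := by
    have h := (hX.hasGaussianLaw_add (s := s) (t := t)).charFun_map_eq 1
    have hm : ∫ ω, X s ω + X t ω ∂μ = 0 := by
      rw [integral_add (hL s).integrable (hL t).integrable, hmean, hmean, add_zero]
    have hv : Var[fun ω => X s ω + X t ω; μ] = 2 * (v + cov[X s, X t; μ]) := by
      rw [variance_fun_add (hL s).memLp_two (hL t).memLp_two, hvar, hvar]; ring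
    rw [charFun_apply_real, integral_map (hX.hasGaussianLaw_add).aemeasurable (by fun_prop)] at h
    simp only [Pi.add_apply, Complex.ofReal_one, one_mul, RCLike.inner_apply, map_one, mul_one, hm, hv] at h
    rw [h]
    push_cast
    congr 1
    ring
  have hcont' : Continuous fun t => ∫ ω, Complex.exp ((X s ω + X t ω : ℝ) * Complex.I) ∂μ := by
    refine continuous_of_dominated (bound := fun _ => 1) (fun t => ?_) (fun t => ?_)
      (integrable_const _) (.of_forall fun ω => ?_)
    · have h1 := (hL s).aemeasurable
      have h2 := (hL t).aemeasurable
      exact AEMeasurable.aestronglyMeasurable (by fun_prop)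
    · exact .of_forall fun ω => (Complex.norm_exp_ofReal_mul_I _).le
    · have := hcont ω
      fun_prop
  simp only [hchar] at hcont'
  have hexp := Complex.continuous_re.comp hcont'
  have hlog := (hexp.log fun t => by
    simp only [Function.comp_apply, Complex.ofReal_re]; positivity).neg.sub
      (continuous_const (y := v))
  refine hlog.congr fun t => ?_
  simp only [Pi.sub_apply, Pi.neg_apply, Function.comp_apply, Complex.ofReal_re, Real.log_exp]
  ring

/-- Almost surely, if a standardized Gaussian process stays in `[-x, x]`, it does so after a small
shift along the covariance function `cov[X s, ·]`. -/
theorem ae_exists_forall_abs_add_covariance_le (hX : IsGaussianProcess X μ)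
    (hvar : ∀ t, Var[X t; μ] = 1) (s : T) (d : ℕ → T) (x : ℝ) :
    ∀ᵐ ω ∂μ, (∀ n, |X (d n) ω| ≤ x) →
      ∃ δ > 0, ∀ n, |X (d n) ω + cov[X s, X (d n); μ] * δ| ≤ x ∧
        |X (d n) ω - cov[X s, X (d n); μ] * δ| ≤ x := by
  classical
  have := hX.isProbabilityMeasure
  have hL (t : T) := hX.hasGaussianLaw_eval t
  let ρ (n : ℕ) : ℝ := cov[X s, X (d n); μ]
  let Y (n : ℕ) (ω : Ω) : ℝ := X (d n) ω - ρ n * X s ω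
  have hY (n : ℕ) : AEMeasurable (Y n) μ :=
    (hL _).aemeasurable.sub ((hL s).aemeasurable.const_mul _)
  have hjoint : IsGaussianProcess (Sum.elim Y fun _ : Unit => X s) μ := by
    refine hX.of_isGaussianProcess fun i => ?_
    cases i with
    | inl n =>
      exact ⟨{d n, s}, .proj ⟨d n, by simp⟩ - ρ n • .proj ⟨s, by simp⟩, fun ω => by
        simp [Y]⟩
    | inr _ => exact ⟨{s}, .proj ⟨s, by simp⟩, fun ω => by simp⟩
  have hind : IndepFun (fun ω n => Y n ω) (X s) μ := by
    refine (hjoint.indepFun_of_covariance_eq_zero hY (fun _ => (hL s).aemeasurable)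
      fun n _ => ?_).comp measurable_id (measurable_pi_apply ())
    have : Y n = X (d n) - fun ω => ρ n * X s ω := rfl
    rw [this, covariance_sub_left (hL _).memLp_two ((hL s).memLp_two.const_mul _) (hL s).memLp_two,
      covariance_const_mul_left, covariance_self (hL s).aemeasurable, hvar, covariance_comm]
    simp [ρ]
  have hac : μ.map (X s) ≪ volume := by
    rw [(hL s).map_eq_gaussianReal, hvar]
    exact gaussianReal_absolutelyContinuous _ (by simp)
  filter_upwards [ae_exists_forall_abs_add_le (hL s).aemeasurable (aemeasurable_pi_lambda _ hY)
    hind hac ρ x] with ω hω hle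
  obtain ⟨δ, hδ, h1, h2⟩ := hω fun n => by simpa [Y] using hle n
  refine ⟨δ, hδ, fun n => ⟨?_, ?_⟩⟩
  · convert h1 n using 2
    simp only [ρ]
    ring
  · convert h2 n using 2
    simp only [ρ]
    ring

/-- The supremum of the absolute value of a standardized Gaussian process with continuous paths on
a compact space has no atoms. -/
theorem ae_iSup_abs_ne [MetricSpace T] [CompactSpace T] [Nonempty T]
    (hX : IsGaussianProcess X μ) (hcont : ∀ ω, Continuous fun t => X t ω)
    (hmean : ∀ t, ∫ ω, X t ω ∂μ = 0) (hvar : ∀ t, Var[X t; μ] = 1) (x : ℝ) :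
    ∀ᵐ ω ∂μ, ⨆ t, |X t ω| ≠ x := by
  let d := TopologicalSpace.denseSeq T
  have hd : DenseRange d := TopologicalSpace.denseRange_denseSeq T
  have hρ := hX.continuous_covariance hcont hmean hvar
  filter_upwards [ae_all_iff.2 fun m =>
    hX.ae_exists_forall_abs_add_covariance_le hvar (d m) d x] with ω hω hsup
  have habs : Continuous fun t => |X t ω| := (hcont ω).abs
  have hbdd : BddAbove (Set.range fun t => |X t ω|) := (isCompact_range habs).bddAbove
  obtain ⟨t, ht⟩ : ∃ t, |X t ω| = x := hsup ▸ (isCompact_range habs).sSup_mem (Set.range_nonempty _)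
  have hzero (m : ℕ) : cov[X t, X (d m); μ] = 0 := by
    obtain ⟨δ, hδ, h⟩ := hω m fun n => hsup ▸ le_ciSup hbdd (d n)
    have hX' := hcont ω
    have hρm := hρ (d m)
    have h1 : |X t ω + cov[X (d m), X t; μ] * δ| ≤ x :=
      hd.induction_on (p := fun t => |X t ω + cov[X (d m), X t; μ] * δ| ≤ x) t
        (isClosed_le (by fun_prop) continuous_const) fun n => (h n).1
    have h2 : |X t ω - cov[X (d m), X t; μ] * δ| ≤ x :=
      hd.induction_on (p := fun t => |X t ω - cov[X (d m), X t; μ] * δ| ≤ x) t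
        (isClosed_le (by fun_prop) continuous_const) fun n => (h n).2
    rw [covariance_comm]
    refine (mul_eq_zero.1 ?_).resolve_right hδ.ne'
    rw [abs_le] at h1 h2
    rcases abs_cases (X t ω) with ⟨h3, -⟩ | ⟨h3, -⟩ <;> linarith
  have h0 : cov[X t, X t; μ] = 0 :=
    hd.induction_on (p := fun s => cov[X t, X s; μ] = 0) t
      (isClosed_eq (hρ t) continuous_const) hzero
  rw [covariance_self (hX.aemeasurable t), hvar] at h0
  exact one_ne_zero h0

end ProbabilityTheory.IsGaussianProcess

/-- The distribution function of a random variable without atoms is continuous. -/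
theorem continuous_measure_setOf_le {Ω : Type*} [MeasurableSpace Ω] {μ : Measure Ω}
    [IsFiniteMeasure μ] {M : Ω → ℝ} (hM : AEMeasurable M μ) (hne : ∀ x, ∀ᵐ ω ∂μ, M ω ≠ x) :
    Continuous fun x => (μ {ω | M ω ≤ x}).toReal := by
  have hmeas (x : ℝ) : NullMeasurableSet {ω | M ω ≤ x} μ :=
    nullMeasurableSet_le hM aemeasurable_const
  have hint (x : ℝ) : (μ {ω | M ω ≤ x}).toReal =
      ∫ ω, {ω | M ω ≤ x}.indicator (fun _ => (1 : ℝ)) ω ∂μ := by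
    rw [integral_indicator₀ (hmeas x)]
    simp [measureReal_def]
  simp_rw [hint]
  refine continuous_iff_continuousAt.2 fun x => ?_
  refine continuousAt_of_dominated (bound := fun _ => 1)
    (.of_forall fun y => aestronglyMeasurable_const.indicator₀ (hmeas y))
    (.of_forall fun y => .of_forall fun ω => ?_) (integrable_const _) ?_
  · exact (norm_indicator_le_norm_self _ _).trans (by simp)
  · filter_upwards [hne x] with ω hω
    rcases lt_or_gt_of_ne hω with h | h
    · refine (continuousAt_const (y := (1 : ℝ))).congr ?_
      filter_upwards [lt_mem_nhds h] with y hy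
      simp [hy.le]
    · refine (continuousAt_const (y := (0 : ℝ))).congr ?_
      filter_upwards [gt_mem_nhds h] with y hy
      simp [hy]

/-- continuity of the distribution function of the supremum of a unit-variance
Gaussian process with continuous paths on a compact metric space. -/
theorem sup_gaussian_cdf_continuous
    {T : Type*} [MetricSpace T] [CompactSpace T] [Nonempty T]
    {Ω : Type*} [MeasurableSpace Ω] (μ : Measure Ω) [IsProbabilityMeasure μ]
    (Z : Ω → T → ℝ)
    (hcont : ∀ ω, Continuous (Z ω))
    (hgauss : ∀ (k : ℕ) (t : Fin k → T) (c : Fin k → ℝ),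
      IsGaussianRV μ fun ω => ∑ i, c i * Z ω (t i))
    (hmean : ∀ t, ∫ ω, Z ω t ∂μ = 0)
    (hvar : ∀ t, ∫ ω, (Z ω t) ^ 2 ∂μ = 1) :
    Continuous fun x₀ : ℝ => (μ {ω : Ω | (⨆ t : T, |Z ω t|) ≤ x₀}).toReal := by
  have hX : IsGaussianProcess (fun t ω => Z ω t) μ := isGaussianProcess_of_isGaussianRV hgauss
  have hvar' (t : T) : Var[fun ω => Z ω t; μ] = 1 := by
    rw [variance_of_integral_eq_zero (hX.aemeasurable t) (hmean t)]
    exact hvar t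
  refine continuous_measure_setOf_le ?_ fun x => hX.ae_iSup_abs_ne hcont hmean hvar' x
  have hsup (ω : Ω) : ⨆ t, |Z ω t| = ⨆ n, |Z ω (TopologicalSpace.denseSeq T n)| :=
    (((TopologicalSpace.denseRange_denseSeq T).ciSup' (hcont ω).abs).symm).trans
      (iSup_range' (fun t => |Z ω t|) _)
  simp_rw [hsup]
  exact .iSup fun n => (hX.aemeasurable _).abs

end
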